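/- arXiv:0903.0502 — 12 statements merged into one kernel-verified Lean document; each statement's English description precedes it below -/
import Mathlib

section
/- Let E be a finite-dimensional real vector space and let (α_i)_{i∈I} and (β_j)_{j∈J} be finite families of linear forms on E whose union spans the dual space E*. Let (x_n) be a sequence in E such that for every i ∈ I the sequence (α_i(x_n))_n is bounded, and for every j ∈ J one has β_j(x_n) → +∞. Then there exists z ∈ E with α_i(z) = 0 for all i ∈ I and β_j(z) > 0 for all j ∈ J. (Lemme 3.2.9) -/
/-- Every linear map between vector spaces has a generalized inverse. -/
theorem LinearMap.exists_generalizedInverse {K V W : Type*} [DivisionRing K] [AddCommGroup V]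
    [Module K V] [AddCommGroup W] [Module K W] (f : V →ₗ[K] W) :
    ∃ g : W →ₗ[K] V, ∀ v, f (g (f v)) = f v := by
  obtain ⟨s, hs⟩ := f.rangeRestrict.exists_rightInverse_of_surjective f.range_rangeRestrict
  obtain ⟨g, hg⟩ := s.exists_extend
  refine ⟨g, fun v => ?_⟩
  have h₁ : g (f v) = s (f.rangeRestrict v) := LinearMap.congr_fun hg (f.rangeRestrict v)
  have h₂ : f.rangeRestrict (s (f.rangeRestrict v)) = f.rangeRestrict v :=
    LinearMap.congr_fun hs (f.rangeRestrict v)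
  rw [h₁]
  exact congrArg Subtype.val h₂

/-- A linear form on `I → ℝ` is bounded above on every box. -/
theorem LinearMap.exists_le_of_abs_le {I : Type*} [Finite I] (φ : (I → ℝ) →ₗ[ℝ] ℝ) (M : I → ℝ) :
    ∃ C : ℝ, ∀ v : I → ℝ, (∀ i, |v i| ≤ M i) → φ v ≤ C := by
  classical
  have := Fintype.ofFinite I
  refine ⟨∑ i, M i * |φ (fun j => if i = j then 1 else 0)|, fun v hv => ?_⟩
  rw [φ.pi_apply_eq_sum_univ v]
  refine Finset.sum_le_sum fun i _ => (le_abs_self _).trans ?_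
  rw [smul_eq_mul, abs_mul]
  gcongr
  exact hv i

/-- **Lemme 3.2.9.** Let `E` be a finite-dimensional real vector space and `(α i)`, `(β j)` finite
families of linear forms whose union spans the dual space. If `(x n)` is a sequence in `E` such
that each `α i (x n)` is bounded and each `β j (x n) → +∞`, then there is `z ∈ E` with
`α i z = 0` for all `i` and `β j z > 0` for all `j`. -/
theorem exists_zero_pos_of_bounded_tendsto_atTop
    {E : Type*} [AddCommGroup E] [Module ℝ E] [FiniteDimensional ℝ E]
    {I J : Type*} [Finite I] [Finite J]
    (α : I → (E →ₗ[ℝ] ℝ)) (β : J → (E →ₗ[ℝ] ℝ))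
    (hspan : Submodule.span ℝ (Set.range α ∪ Set.range β) = ⊤)
    (x : ℕ → E)
    (hα : ∀ i, ∃ M : ℝ, ∀ n, |α i (x n)| ≤ M)
    (hβ : ∀ j, Filter.Tendsto (fun n => β j (x n)) Filter.atTop Filter.atTop) :
    ∃ z : E, (∀ i, α i z = 0) ∧ ∀ j, 0 < β j z := by
  obtain ⟨g, hg⟩ := (LinearMap.pi α).exists_generalizedInverse
  choose M hM using hα
  choose C hC using fun j => (β j ∘ₗ g).exists_le_of_abs_le M
  obtain ⟨n, hn⟩ := (Filter.eventually_all.2 fun j => (hβ j).eventually_gt_atTop (C j)).exists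
  refine ⟨x n - g (LinearMap.pi α (x n)), fun i => ?_, fun j => ?_⟩
  · rw [map_sub, sub_eq_zero]
    exact (congrFun (hg (x n)) i).symm
  · rw [map_sub, sub_pos]
    exact (hC j (LinearMap.pi α (x n)) fun i => hM i n).trans_lt (hn j)
end

section
/- Let V be a finite-dimensional real normed vector space and let (α_i)_{i∈I}, (β_j)_{j∈J} be finite families of linear forms on V whose union spans the dual space V*. Set f = {x ∈ V : α_i(x) = 0 for all i ∈ I and β_j(x) > 0 for all j ∈ J}. Let U be a neighborhood of 0 in V and let (x_n) be a sequence in V such that α_i(x_n) → 0 for every i ∈ I and β_j(x_n) → +∞ for every j ∈ J. Then x_n ∈ U + f for all sufficiently large n. (Lemme 3.2.3) -/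
open Pointwise Filter

/-- **Lemme 3.2.3.** Let `V` be a finite-dimensional real normed space, `(α i)`, `(β j)` finite
families of linear forms whose union spans the dual space, and
`f = {x | ∀ i, α i x = 0 ∧ ∀ j, 0 < β j x}`.  If `U` is a neighbourhood of `0` and `(x n)` is a
sequence with `α i (x n) → 0` and `β j (x n) → +∞`, then `x n ∈ U + f` for `n` large enough. -/
theorem eventually_mem_add_cone_of_tendsto
    {V : Type*} [NormedAddCommGroup V] [NormedSpace ℝ V] [FiniteDimensional ℝ V]
    {I J : Type*} [Finite I] [Finite J]
    (α : I → (V →ₗ[ℝ] ℝ)) (β : J → (V →ₗ[ℝ] ℝ))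
    (hspan : Submodule.span ℝ (Set.range α ∪ Set.range β) = ⊤)
    (f : Set V) (hf : f = {x : V | (∀ i, α i x = 0) ∧ ∀ j, 0 < β j x})
    (U : Set V) (hU : U ∈ nhds (0 : V))
    (x : ℕ → V)
    (hα : ∀ i, Tendsto (fun n => α i (x n)) atTop (nhds 0))
    (hβ : ∀ j, Tendsto (fun n => β j (x n)) atTop atTop) :
    ∀ᶠ n in atTop, x n ∈ U + f := by
  subst hf
  have := Fintype.ofFinite I
  let A : V →ₗ[ℝ] (I → ℝ) := LinearMap.pi α
  obtain ⟨S, hS⟩ := A.rangeRestrict.exists_rightInverse_of_surjective A.range_rangeRestrict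
  have hA : Tendsto (fun n => A.rangeRestrict (x n)) atTop (nhds 0) :=
    tendsto_subtype_rng.2 (tendsto_pi_nhds.2 hα)
  have hy : Tendsto (fun n => S (A.rangeRestrict (x n))) atTop (nhds 0) :=
    (S.continuous_of_finiteDimensional.tendsto' 0 0 (map_zero S)).comp hA
  have hker : ∀ n i, α i (x n - S (A.rangeRestrict (x n))) = 0 := fun n i => by
    have h : A (S (A.rangeRestrict (x n))) = A (x n) :=
      congrArg Subtype.val (LinearMap.congr_fun hS (A.rangeRestrict (x n)))
    rw [map_sub, sub_eq_zero]
    exact (congrFun h i).symm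
  have hpos : ∀ᶠ n in atTop, ∀ j, 0 < β j (x n - S (A.rangeRestrict (x n))) := by
    refine eventually_all.2 fun j => ?_
    have hβy : Tendsto (fun n => -β j (S (A.rangeRestrict (x n)))) atTop (nhds (-0)) :=
      (((β j).continuous_of_finiteDimensional.tendsto' 0 0 (map_zero (β j))).comp hy).neg
    filter_upwards [((hβ j).atTop_add hβy).eventually_gt_atTop 0] with n hn
    simpa [sub_eq_add_neg] using hn
  filter_upwards [hy.eventually_mem hU, hpos] with n hU hn
  exact Set.mem_add.2 ⟨_, hU, _, ⟨hker n, hn⟩, add_sub_cancel _ _⟩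
end

section
/- Let F be an admissible cone decomposition of V. Then the relation 'being equivalent' is an equivalence relation on the set of F-cones of V. Moreover, if two equivalent F-cones x + f and y + f (with f ∈ F) contain a common point z, then the F-cone z + f is contained in (x + f) ∩ (y + f). (Proposition 3.1.2) -/
open Pointwise Filter Set

/-- The affine cone with vertex `a` and direction `f`, i.e. the set `a + f`. -/
def coneSet {V : Type*} [Add V] (a : V) (f : Set V) : Set V := (a + ·) '' f

/-- `F` is an admissible cone decomposition of `V`: a finite set of nonempty subsets of `V`
satisfying (H1) `V` is the disjoint union of the members of `F`; (H3) `{0} ∈ F`;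
(H4) every `f ∈ F` is described by a finite system of linear equations and strict linear
inequations; (H5) the boundary (in its linear span) of every `f ∈ F` is a union of members
of `F`; (H6) if `f` is contained in the boundary of `g`, then `f = span f ∩ closure g`. -/
structure IsAdmissibleConeDecomp (V : Type*) [NormedAddCommGroup V]
    [InnerProductSpace ℝ V] (F : Set (Set V)) : Prop where
  finite : F.Finite
  nonempty : ∀ f ∈ F, f.Nonempty
  pairwiseDisjoint : ∀ f ∈ F, ∀ g ∈ F, f ≠ g → f ∩ g = ∅
  covers : ⋃₀ F = Set.univ
  zero_mem : ({0} : Set V) ∈ F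
  polyhedral : ∀ f ∈ F, ∃ A B : Finset (V →ₗ[ℝ] ℝ),
      f = {x : V | (∀ α ∈ A, α x = 0) ∧ ∀ β ∈ B, 0 < β x}
  boundary_union : ∀ f ∈ F, ∃ G ⊆ F, closure f \ f = ⋃₀ G
  face_eq : ∀ f ∈ F, ∀ g ∈ F, f ⊆ closure g \ g →
      f = ↑(Submodule.span ℝ f) ∩ closure g

/-- Two `F`-cones (encoded as a vertex together with a direction in `F`) are equivalent
when they have the same direction and nonempty intersection. -/
def ConeRel {V : Type*} [Add V] (F : Set (Set V)) :
    (V × {f : Set V // f ∈ F}) → (V × {f : Set V // f ∈ F}) → Prop :=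
  fun p q => p.2 = q.2 ∧ (coneSet p.1 p.2.1 ∩ coneSet q.1 q.2.1).Nonempty

/-- The compactification `V̄`: the set of equivalence classes of `F`-cones. -/
abbrev ConeCompactification {V : Type*} [Add V] (F : Set (Set V)) : Type _ :=
  Quot (ConeRel F)

/-- `𝒱(g, U)`: the set of points of `V̄` having a representative contained in `g + U`. -/
def VNbhd {V : Type*} [Add V] (F : Set (Set V)) (g : V × {f : Set V // f ∈ F})
    (U : Set V) : Set (ConeCompactification F) :=
  {x | ∃ p : V × {f : Set V // f ∈ F},
      Quot.mk (ConeRel F) p = x ∧ coneSet p.1 p.2.1 ⊆ coneSet g.1 g.2.1 + U}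

theorem IsAdmissibleConeDecomp.add_mem {V : Type*} [NormedAddCommGroup V]
    [InnerProductSpace ℝ V] {F : Set (Set V)} (hF : IsAdmissibleConeDecomp V F)
    {f : Set V} (hf : f ∈ F) {a b : V} (ha : a ∈ f) (hb : b ∈ f) : a + b ∈ f := by
  obtain ⟨A, B, rfl⟩ := hF.polyhedral f hf
  refine ⟨fun α hα => ?_, fun β hβ => ?_⟩
  · rw [map_add, ha.1 α hα, hb.1 α hα, add_zero]
  · rw [map_add]
    exact add_pos (ha.2 β hβ) (hb.2 β hβ)

theorem coneSet_subset_of_mem {V : Type*} [AddSemigroup V] {f : Set V}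
    (hf : ∀ a ∈ f, ∀ b ∈ f, a + b ∈ f) {x z : V} (hz : z ∈ coneSet x f) :
    coneSet z f ⊆ coneSet x f := by
  obtain ⟨a, ha, rfl⟩ := hz
  rintro _ ⟨b, hb, rfl⟩
  exact ⟨a + b, hf a ha b hb, (add_assoc x a b).symm⟩

/-- **Proposition 3.1.2.** "Being equivalent" is an equivalence relation on the set of `F`-cones.
Moreover, if two equivalent `F`-cones `x + f` and `y + f` contain a common point `z`, then the
`F`-cone `z + f` is contained in `(x + f) ∩ (y + f)`. -/
theorem coneRel_equivalence
    {V : Type*} [NormedAddCommGroup V] [InnerProductSpace ℝ V] [FiniteDimensional ℝ V]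
    {F : Set (Set V)} (hF : IsAdmissibleConeDecomp V F) :
    Equivalence (ConeRel F) ∧
      ∀ f ∈ F, ∀ x y z : V, z ∈ coneSet x f ∩ coneSet y f →
        coneSet z f ⊆ coneSet x f ∩ coneSet y f := by
  refine ⟨⟨fun ⟨x, f, hf⟩ => ⟨rfl, ?_⟩, fun h => ⟨h.1.symm, ?_⟩, ?_⟩, ?_⟩
  · obtain ⟨a, ha⟩ := hF.nonempty f hf
    exact ⟨x + a, ⟨a, ha, rfl⟩, ⟨a, ha, rfl⟩⟩
  · rw [inter_comm]
    exact h.2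
  · rintro ⟨x, f, hf⟩ ⟨y, _, _⟩ ⟨w, _, _⟩ ⟨⟨⟩, _, ⟨a, ha, rfl⟩, b, hb, hab⟩
      ⟨⟨⟩, _, ⟨c, hc, rfl⟩, d, hd, hcd⟩
    refine ⟨rfl, x + (a + c), ⟨a + c, hF.add_mem hf ha hc, rfl⟩, d + b, hF.add_mem hf hd hb, ?_⟩
    dsimp only at hab hcd ⊢
    rw [← add_assoc, ← add_assoc, hcd, ← hab, add_right_comm]
  · intro f hf x y z hz
    have hadd : ∀ a ∈ f, ∀ b ∈ f, a + b ∈ f := fun a ha b hb => hF.add_mem hf ha hb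
    exact subset_inter (coneSet_subset_of_mem hadd hz.1) (coneSet_subset_of_mem hadd hz.2)
end

section
/- Let F be an admissible cone decomposition of V and let f ∈ F. For all x, y ∈ V, the F-cones x + f and y + f are equivalent if and only if x − y ∈ span(f). Consequently, the map sending the coset x + span(f) to the equivalence class of x + f is a well-defined bijection from the quotient vector space V/span(f) onto the façade V_f (the set of equivalence classes of F-cones with direction f), so that V_f is an affine space with direction V/span(f). (Proposition 3.1.4) -/
open Pointwise Filter Set

/-- Every vector of the span of a nonempty set given by linear equations and finitely many strict
linear inequations is a difference of two elements of that set. -/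
theorem exists_mem_add_mem_of_mem_span {V : Type*} [AddCommGroup V] [Module ℝ V]
    (A B : Finset (V →ₗ[ℝ] ℝ)) {f : Set V}
    (hf : f = {x : V | (∀ α ∈ A, α x = 0) ∧ ∀ β ∈ B, 0 < β x}) (hne : f.Nonempty)
    {v : V} (hv : v ∈ Submodule.span ℝ f) : ∃ w ∈ f, v + w ∈ f := by
  obtain ⟨e, he⟩ := hne
  have he' : (∀ α ∈ A, α e = 0) ∧ ∀ β ∈ B, 0 < β e := by rwa [hf] at he
  have hvA : ∀ α ∈ A, α v = 0 := by
    intro α hα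
    have hle : Submodule.span ℝ f ≤ LinearMap.ker α :=
      Submodule.span_le.2 fun x hx => by
        rw [hf] at hx
        exact hx.1 α hα
    exact hle hv
  have hlarge : ∀ᶠ t : ℝ in atTop, ∀ β ∈ B, 0 < β v + t * β e := by
    rw [Filter.eventually_all_finset]
    intro β hβ
    exact (tendsto_atTop_add_const_left _ _
      (tendsto_id.atTop_mul_const (he'.2 β hβ))).eventually_gt_atTop 0
  obtain ⟨t, ht, ht0⟩ := (hlarge.and (eventually_gt_atTop 0)).exists
  refine ⟨t • e, ?_, ?_⟩
  · rw [hf]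
    exact ⟨fun α hα => by simp [he'.1 α hα],
      fun β hβ => by simpa using mul_pos ht0 (he'.2 β hβ)⟩
  · rw [hf]
    exact ⟨fun α hα => by simp [hvA α hα, he'.1 α hα], fun β hβ => by simpa using ht β hβ⟩

/-- Two translates of a member `f` of an admissible cone decomposition meet iff their vertices
differ by an element of the span of `f`. -/
theorem IsAdmissibleConeDecomp.coneSet_inter_nonempty_iff
    {V : Type*} [NormedAddCommGroup V] [InnerProductSpace ℝ V]
    {F : Set (Set V)} (hF : IsAdmissibleConeDecomp V F) {f : Set V} (hf : f ∈ F) (x y : V) :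
    (coneSet x f ∩ coneSet y f).Nonempty ↔ x - y ∈ Submodule.span ℝ f := by
  constructor
  · rintro ⟨_, ⟨a, ha, rfl⟩, b, hb, hab⟩
    have h : x - y = b - a := by
      rw [sub_eq_sub_iff_add_eq_add, add_comm b y]
      exact hab.symm
    rw [h]
    exact sub_mem (Submodule.subset_span hb) (Submodule.subset_span ha)
  · intro h
    obtain ⟨A, B, hAB⟩ := hF.polyhedral f hf
    obtain ⟨w, hw, hvw⟩ := exists_mem_add_mem_of_mem_span A B hAB (hF.nonempty f hf) h
    exact ⟨x + w, ⟨w, hw, rfl⟩, x - y + w, hvw, by simp only; abel⟩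

/-- **Proposition 3.1.4.** For `f ∈ F`, the cones `x + f` and `y + f` are equivalent iff
`x - y ∈ span f`.  Consequently, the map sending the coset `x + span f` to the class of `x + f`
is a well-defined bijection from `V ⧸ span f` onto the façade `V_f`, so that the façade is an
affine space directed by `V ⧸ span f`. -/
theorem facade_equiv_quotient
    {V : Type*} [NormedAddCommGroup V] [InnerProductSpace ℝ V] [FiniteDimensional ℝ V]
    {F : Set (Set V)} (hF : IsAdmissibleConeDecomp V F)
    (f : Set V) (hf : f ∈ F) :
    (∀ x y : V, (coneSet x f ∩ coneSet y f).Nonempty ↔ x - y ∈ Submodule.span ℝ f) ∧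
    ∃ φ : (V ⧸ Submodule.span ℝ f) →
        Quot (fun x y : V => (coneSet x f ∩ coneSet y f).Nonempty),
      Function.Bijective φ ∧
        ∀ x : V, φ (Submodule.Quotient.mk x) =
          Quot.mk (fun x y : V => (coneSet x f ∩ coneSet y f).Nonempty) x := by
  have key := hF.coneSet_inter_nonempty_iff hf
  have hmk : ∀ x y : V, (coneSet x f ∩ coneSet y f).Nonempty ↔
      (Submodule.Quotient.mk x : V ⧸ Submodule.span ℝ f) = Submodule.Quotient.mk y :=
    fun x y => (key x y).trans (Submodule.Quotient.eq _).symm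
  have hsurj := Submodule.Quotient.mk_surjective (Submodule.span ℝ f)
  have hφ : ∀ x : V,
      Quot.mk (fun x y : V => (coneSet x f ∩ coneSet y f).Nonempty)
        (Function.surjInv hsurj (Submodule.Quotient.mk x)) = Quot.mk _ x :=
    fun x => Quot.sound ((hmk _ _).2 (Function.surjInv_eq hsurj _))
  refine ⟨key, fun q => Quot.mk _ (Function.surjInv hsurj q), ⟨fun p q hpq => ?_, ?_⟩, hφ⟩
  · have h := congrArg (Quot.lift (Submodule.Quotient.mk (p := Submodule.span ℝ f))
      fun x y hxy => (hmk x y).1 hxy) hpq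
    simpa only [Function.surjInv_eq hsurj] using h
  · rintro ⟨x⟩
    exact ⟨Submodule.Quotient.mk x, hφ x⟩
end

section
/- Let F be an admissible cone decomposition of V and let i : V → V̄ be the canonical injection sending x ∈ V to the class of the F-cone x + {0}. Then i is injective, continuous and open, its image is dense in V̄, and for every F-cone g and every neighborhood U of 0 in V one has i^{-1}(𝒱(g, U)) = g + U. (Proposition 3.2.7) -/
open Pointwise Filter Set

/-- `T` is the topology on `V̄` for which, at every point `x`, the sets `𝒱(g, U)` (for `g` a
representative of `x` and `U` a neighbourhood of `0` in `V`) form a neighbourhood basis. -/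
def IsConeTopology {V : Type*} [NormedAddCommGroup V] (F : Set (Set V))
    (T : TopologicalSpace (ConeCompactification F)) : Prop :=
  ∀ x : ConeCompactification F,
    (@nhds _ T x).HasBasis
      (fun gU : (V × {f : Set V // f ∈ F}) × Set V =>
        Quot.mk (ConeRel F) gU.1 = x ∧ gU.2 ∈ nhds (0 : V))
      fun gU => VNbhd F gU.1 gU.2

/-- If the direction `{0}` occurs, equivalent cones are equal. -/
theorem ConeRel.eq_of_direction_zero {V : Type*} [AddMonoid V] {F : Set (Set V)}
    {p q : V × {f : Set V // f ∈ F}} (h : ConeRel F p q) (hp : p.2.1 = {0}) : p = q := by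
  obtain ⟨a, f⟩ := p
  obtain ⟨b, g⟩ := q
  obtain ⟨rfl, z, hz, hz'⟩ := h
  simp only at hp
  simp only [coneSet, hp, image_singleton, add_zero, mem_singleton_iff] at hz hz'
  rw [← hz, hz']

/-- The class of a cone of direction `{0}` has only one representative. -/
theorem eq_of_quot_mk_eq_of_direction_zero {V : Type*} [AddMonoid V] {F : Set (Set V)}
    {p q : V × {f : Set V // f ∈ F}} (h : Quot.mk (ConeRel F) p = Quot.mk (ConeRel F) q)
    (hq : q.2.1 = {0}) : p = q := by
  have key : ∀ r s, Relation.EqvGen (ConeRel F) r s →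
      (r.2.1 = {0} ∨ s.2.1 = {0}) → r = s := by
    intro r s hrs
    induction hrs with
    | rel r s hrs =>
      intro h0
      refine hrs.eq_of_direction_zero ?_
      rcases h0 with h0 | h0
      · exact h0
      · rw [hrs.1, h0]
    | refl => exact fun _ => rfl
    | symm r s _ ih => exact fun h0 => (ih h0.symm).symm
    | trans r s t _ _ ih₁ ih₂ =>
      rintro (h0 | h0)
      · obtain rfl := ih₁ (Or.inl h0)
        exact ih₂ (Or.inl h0)
      · obtain rfl := ih₂ (Or.inr h0)
        exact ih₁ (Or.inr h0)
  exact key p q (Quot.eqvGen_exact h) (Or.inr hq)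

/-- The class of the vertex `x` lies in `𝒱(g, U)` exactly when `x ∈ g + U`. -/
theorem quot_mk_mem_VNbhd_iff {V : Type*} [AddMonoid V] {F : Set (Set V)}
    (h0 : ({0} : Set V) ∈ F) (g : V × {f : Set V // f ∈ F}) (U : Set V) (x : V) :
    Quot.mk (ConeRel F) (x, ⟨{0}, h0⟩) ∈ VNbhd F g U ↔ x ∈ coneSet g.1 g.2.1 + U := by
  constructor
  · rintro ⟨p, hp, hsub⟩
    obtain rfl := eq_of_quot_mk_eq_of_direction_zero hp rfl
    exact hsub ⟨0, rfl, add_zero x⟩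
  · intro hx
    refine ⟨_, rfl, ?_⟩
    simpa [coneSet] using hx

theorem IsAdmissibleConeDecomp.smul_mem {V : Type*} [NormedAddCommGroup V]
    [InnerProductSpace ℝ V] {F : Set (Set V)} (hF : IsAdmissibleConeDecomp V F)
    {f : Set V} (hf : f ∈ F) {v : V} (hv : v ∈ f) {t : ℝ} (ht : 0 < t) : t • v ∈ f := by
  obtain ⟨A, B, rfl⟩ := hF.polyhedral f hf
  refine ⟨fun α hα => ?_, fun β hβ => ?_⟩
  · rw [map_smul, hv.1 α hα, smul_zero]
  · rw [map_smul, smul_eq_mul]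
    exact mul_pos ht (hv.2 β hβ)

/-- A cone of the decomposition with a translate inside a ball is `{0}`. -/
theorem IsAdmissibleConeDecomp.eq_zero_of_coneSet_subset_ball {V : Type*}
    [NormedAddCommGroup V] [InnerProductSpace ℝ V] {F : Set (Set V)}
    (hF : IsAdmissibleConeDecomp V F) {f : Set V} (hf : f ∈ F) {a x : V} {ε : ℝ}
    (h : coneSet a f ⊆ Metric.ball x ε) : f = {0} := by
  refine (hF.nonempty f hf).subset_singleton_iff.mp fun v hv => ?_
  by_contra hv0
  have hpos : 0 < ‖v‖ := norm_pos_iff.mpr hv0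
  have hC : 0 < ‖a - x‖ + |ε| + 1 := by positivity
  have hmem := h ⟨_, hF.smul_mem hf hv (div_pos hC hpos), rfl⟩
  rw [mem_ball_iff_norm] at hmem
  set w := ((‖a - x‖ + |ε| + 1) / ‖v‖) • v with hw
  have hwn : ‖w‖ = ‖a - x‖ + |ε| + 1 := by
    rw [hw, norm_smul, Real.norm_of_nonneg (div_pos hC hpos).le, div_mul_cancel₀ _ hpos.ne']
  have htri : ‖w‖ ≤ ‖a + w - x‖ + ‖a - x‖ := by
    have := norm_sub_le (a + w - x) (a - x)
    rwa [show a + w - x - (a - x) = w by abel] at this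
  linarith [le_abs_self ε]

/-- **Proposition 3.2.7.** The canonical injection `i : V → V̄`, sending `x` to the class of the
`F`-cone `x + {0}`, is injective, continuous and open, its image is dense in `V̄`, and for every
`F`-cone `g` and every neighbourhood `U` of `0` in `V` one has `i ⁻¹' 𝒱(g, U) = g + U`. -/
theorem canonical_injection_properties
    {V : Type*} [NormedAddCommGroup V] [InnerProductSpace ℝ V] [FiniteDimensional ℝ V]
    {F : Set (Set V)} (hF : IsAdmissibleConeDecomp V F)
    (T : TopologicalSpace (ConeCompactification F)) (hT : IsConeTopology F T) :
    Function.Injective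
        (fun x : V => Quot.mk (ConeRel F) (x, ⟨({0} : Set V), hF.zero_mem⟩)) ∧
    @Continuous V (ConeCompactification F) _ T
        (fun x : V => Quot.mk (ConeRel F) (x, ⟨({0} : Set V), hF.zero_mem⟩)) ∧
    @IsOpenMap V (ConeCompactification F) _ T
        (fun x : V => Quot.mk (ConeRel F) (x, ⟨({0} : Set V), hF.zero_mem⟩)) ∧
    @Dense (ConeCompactification F) T
        (Set.range fun x : V => Quot.mk (ConeRel F) (x, ⟨({0} : Set V), hF.zero_mem⟩)) ∧
    ∀ (g : V × {f : Set V // f ∈ F}) (U : Set V), U ∈ nhds (0 : V) →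
      (fun x : V => Quot.mk (ConeRel F) (x, ⟨({0} : Set V), hF.zero_mem⟩)) ⁻¹' VNbhd F g U =
        coneSet g.1 g.2.1 + U := by
  have hpre := fun g U x => quot_mk_mem_VNbhd_iff (F := F) hF.zero_mem g U x
  refine ⟨fun x y hxy => ?_, ?_, ?_, ?_, fun g U _ => Set.ext fun x => hpre g U x⟩
  · exact congrArg Prod.fst (eq_of_quot_mk_eq_of_direction_zero hxy rfl)
  · refine continuous_iff_continuousAt.mpr fun x => (hT _).tendsto_right_iff.mpr ?_
    rintro ⟨g, U⟩ ⟨hg, hU⟩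
    obtain rfl := eq_of_quot_mk_eq_of_direction_zero hg rfl
    have hU' : ∀ᶠ y in nhds x, y - x ∈ U :=
      (tendsto_sub_nhds_zero_iff.mpr tendsto_id).eventually hU
    filter_upwards [hU'] with y hy
    exact (hpre _ _ _).mpr ⟨x, ⟨0, rfl, add_zero x⟩, y - x, hy, add_sub_cancel x y⟩
  · intro O hO
    rw [isOpen_iff_mem_nhds]
    rintro _ ⟨x, hx, rfl⟩
    obtain ⟨ε, hε, hball⟩ := Metric.isOpen_iff.mp hO x hx
    refine (hT _).mem_iff.mpr ⟨((x, ⟨{0}, hF.zero_mem⟩), Metric.ball 0 ε),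
      ⟨rfl, Metric.ball_mem_nhds 0 hε⟩, ?_⟩
    rintro _ ⟨⟨a, f, hf⟩, rfl, hsub⟩
    have hsub' : coneSet a f ⊆ Metric.ball x ε := by simpa [coneSet] using hsub
    obtain rfl := hF.eq_zero_of_coneSet_subset_ball hf hsub'
    exact ⟨a, hball (hsub' ⟨0, rfl, add_zero a⟩), rfl⟩
  · intro z
    refine (mem_closure_iff_nhds_basis (hT z)).mpr ?_
    rintro ⟨g, U⟩ ⟨-, hU⟩
    obtain ⟨v, hv⟩ := hF.nonempty _ g.2.2
    exact ⟨_, mem_range_self (g.1 + v),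
      (hpre _ _ _).mpr ⟨g.1 + v, ⟨v, hv, rfl⟩, 0, mem_of_mem_nhds hU, add_zero _⟩⟩
end

section
/- Let F be an admissible cone decomposition of V and let w : V → V be a bijective affine map whose linear part maps every member of F onto a member of F. Then the map w̃ : V̄ → V̄ defined by w̃([g]) = [w(g)] for every F-cone g is a well-defined homeomorphism of V̄, and it is the unique continuous map V̄ → V̄ extending w, i.e. satisfying w̃ ∘ i = i ∘ w where i : V → V̄ is the canonical injection. (Proposition 3.3.1) -/
open Pointwise Filter Set

lemma coneSet_zero {V : Type*} [AddZeroClass V] (a : V) : coneSet a ({0} : Set V) = {a} := by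
  simp [coneSet]

section ConeCompactification

variable {V : Type*} [NormedAddCommGroup V] [InnerProductSpace ℝ V] {F : Set (Set V)}

namespace IsAdmissibleConeDecomp

lemma add_mem_s9 (hF : IsAdmissibleConeDecomp V F) {f : Set V} (hf : f ∈ F) {x y : V}
    (hx : x ∈ f) (hy : y ∈ f) : x + y ∈ f := by
  obtain ⟨A, B, rfl⟩ := hF.polyhedral f hf
  refine ⟨fun α hα => ?_, fun β hβ => ?_⟩
  · rw [map_add, hx.1 α hα, hy.1 α hα, add_zero]
  · rw [map_add]
    exact add_pos (hx.2 β hβ) (hy.2 β hβ)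

/-- Far out along a ray of a cone, translating by any element of the cone stays in the cone. -/
lemma eventually_nsmul_sub_mem (hF : IsAdmissibleConeDecomp V F) {f : Set V} (hf : f ∈ F)
    {v p : V} (hv : v ∈ f) (hp : p ∈ f) : ∀ᶠ n : ℕ in atTop, n • v - p ∈ f := by
  obtain ⟨A, B, rfl⟩ := hF.polyhedral f hf
  have hB : ∀ᶠ n : ℕ in atTop, ∀ β ∈ B, β p < n * β v :=
    B.eventually_all.2 fun β hβ =>
      (tendsto_natCast_atTop_atTop.atTop_mul_const (hv.2 β hβ)).eventually_gt_atTop (β p)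
  filter_upwards [hB] with n hn
  refine ⟨fun α hα => ?_, fun β hβ => ?_⟩
  · simp [hv.1 α hα, hp.1 α hα]
  · simpa using hn β hβ

lemma eq_of_mem (hF : IsAdmissibleConeDecomp V F) {f g : Set V} (hf : f ∈ F) (hg : g ∈ F)
    {x : V} (hxf : x ∈ f) (hxg : x ∈ g) : f = g := by
  by_contra hne
  exact (hF.pairwiseDisjoint f hf g hg hne).subset ⟨hxf, hxg⟩

lemma equivalence_coneRel (hF : IsAdmissibleConeDecomp V F) : Equivalence (ConeRel F) where
  refl p := ⟨rfl, by rw [inter_self]; exact (hF.nonempty _ p.2.2).image _⟩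
  symm h := ⟨h.1.symm, by rw [inter_comm]; exact h.2⟩
  trans := by
    rintro ⟨a, f⟩ ⟨b, g⟩ ⟨c, k⟩ ⟨hfg, x, ⟨y, hy, hyx⟩, ⟨z, hz, hzx⟩⟩
      ⟨hgk, x', ⟨y', hy', hyx'⟩, ⟨z', hz', hzx'⟩⟩
    dsimp only at *
    subst hfg hgk
    refine ⟨rfl, a + y + y', ⟨y + y', hF.add_mem_s9 f.2 hy hy', (add_assoc _ _ _).symm⟩,
      ⟨z' + z, hF.add_mem_s9 f.2 hz' hz, ?_⟩⟩
    dsimp only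
    rw [hyx, ← hzx, ← add_assoc, hzx', ← hyx']
    abel

lemma mk_eq_mk_iff (hF : IsAdmissibleConeDecomp V F) {p q : V × {f : Set V // f ∈ F}} :
    Quot.mk (ConeRel F) p = Quot.mk (ConeRel F) q ↔ ConeRel F p q :=
  hF.equivalence_coneRel.quot_mk_eq_iff p q

lemma mk_zero_mem_VNbhd (hF : IsAdmissibleConeDecomp V F) {x : V}
    {g : V × {f : Set V // f ∈ F}} {U : Set V} :
    Quot.mk (ConeRel F) (x, ⟨{0}, hF.zero_mem⟩) ∈ VNbhd F g U ↔
      x ∈ coneSet g.1 g.2.1 + U := by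
  constructor
  · rintro ⟨⟨a, f⟩, hp, hsub⟩
    obtain ⟨rfl, hne⟩ := hF.mk_eq_mk_iff.1 hp
    simp only [coneSet_zero] at hne hsub
    obtain ⟨y, rfl, rfl⟩ := hne
    exact hsub rfl
  · intro hx
    exact ⟨_, rfl, by simpa [coneSet_zero] using hx⟩

/-- The points `a + n v` with `v ∈ f` converge in `V̄` to the class of the cone `a + f`. -/
lemma tendsto_ray (hF : IsAdmissibleConeDecomp V F)
    {T : TopologicalSpace (ConeCompactification F)} (hT : IsConeTopology F T)
    (a : V) (f : {f : Set V // f ∈ F}) {v : V} (hv : v ∈ f.1) :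
    Tendsto (fun n : ℕ => Quot.mk (ConeRel F) (a + n • v, ⟨{0}, hF.zero_mem⟩)) atTop
      (@nhds _ T (Quot.mk (ConeRel F) (a, f))) := by
  refine (hT _).tendsto_right_iff.2 ?_
  rintro ⟨⟨b, g⟩, U⟩ ⟨hmk, hU⟩
  obtain ⟨rfl, y, ⟨q, hq, rfl⟩, ⟨p, hp, hpq⟩⟩ := hF.mk_eq_mk_iff.1 hmk
  dsimp only at *
  filter_upwards [hF.eventually_nsmul_sub_mem g.2 hv hp] with n hn
  rw [hF.mk_zero_mem_VNbhd]
  refine ⟨a + n • v, ⟨q + (n • v - p), hF.add_mem_s9 g.2 hq hn, ?_⟩, 0, mem_of_mem_nhds hU,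
    add_zero _⟩
  dsimp only
  rw [← add_assoc, ← hpq]
  abel

/-- The limit in `V̄` of the points `a + n v`, with `v ∈ f`, is unique. -/
lemma eq_of_tendsto_ray [FiniteDimensional ℝ V] (hF : IsAdmissibleConeDecomp V F)
    {T : TopologicalSpace (ConeCompactification F)} (hT : IsConeTopology F T)
    (a : V) (f : {f : Set V // f ∈ F}) {v : V} (hv : v ∈ f.1) {x : ConeCompactification F}
    (h : Tendsto (fun n : ℕ => Quot.mk (ConeRel F) (a + n • v, ⟨{0}, hF.zero_mem⟩)) atTop
      (@nhds _ T x)) :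
    x = Quot.mk (ConeRel F) (a, f) := by
  obtain ⟨⟨b, g⟩, rfl⟩ := Quot.exists_rep x
  have hev : ∀ c : V, Quot.mk (ConeRel F) (c, g) = Quot.mk (ConeRel F) (b, g) →
      ∀ U ∈ nhds (0 : V), ∀ᶠ n : ℕ in atTop, a + n • v ∈ coneSet c g.1 + U := by
    intro c hc U hU
    filter_upwards [(hT _).tendsto_right_iff.1 h ((c, g), U) ⟨hc, hU⟩] with n hn
    exact hF.mk_zero_mem_VNbhd.1 hn
  obtain ⟨g₀, hg₀⟩ := hF.nonempty _ g.2
  obtain ⟨A, B, hg⟩ := hF.polyhedral _ g.2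
  -- a bound for forms along the ray
  have hbound : ∀ φ : V →ₗ[ℝ] ℝ, ∀ c : V,
      Quot.mk (ConeRel F) (c, g) = Quot.mk (ConeRel F) (b, g) → ∀ ε > 0,
      ∀ᶠ n : ℕ in atTop, ∃ y ∈ g.1, |φ a + n * φ v - φ c - φ y| < ε := by
    intro φ c hc ε hε
    have hφ : Continuous φ := φ.continuous_of_finiteDimensional
    have hU : {u : V | |φ u| < ε} ∈ nhds (0 : V) :=
      (isOpen_lt (by fun_prop) continuous_const).mem_nhds (by simpa using hε)
    filter_upwards [hev c hc _ hU] with n ⟨_, ⟨y, hy, rfl⟩, u, hu, hn⟩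
    refine ⟨y, hy, ?_⟩
    have := congrArg φ hn
    simp only [map_add, map_nsmul, nsmul_eq_mul] at this
    have hu' : |φ u| < ε := hu
    rwa [show φ a + n * φ v - φ c - φ y = φ u by linarith]
  have hA : ∀ α ∈ A, α v = 0 ∧ α a = α b := by
    intro α hα
    have hy0 : ∀ y ∈ g.1, α y = 0 := fun y hy => (hg ▸ hy : y ∈ {x | _}).1 α hα
    have hlim : ∀ ε > 0, ∀ᶠ n : ℕ in atTop, |α a + n * α v - α b| < ε := by
      intro ε hε
      filter_upwards [hbound α b rfl ε hε] with n ⟨y, hy, hn⟩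
      simpa [hy0 y hy] using hn
    have hv0 : α v = 0 := by
      by_contra hne
      have hpos : 0 < |α v| := abs_pos.2 hne
      obtain ⟨n, h1, h2⟩ := ((hlim (|α v| / 2) (by positivity)).and
        ((tendsto_add_atTop_nat 1).eventually (hlim (|α v| / 2) (by positivity)))).exists
      have h3 := abs_sub (α a + ((n + 1 : ℕ) : ℝ) * α v - α b) (α a + n * α v - α b)
      rw [show α a + ((n + 1 : ℕ) : ℝ) * α v - α b - (α a + n * α v - α b) = α v by
        push_cast; ring] at h3
      linarith
    refine ⟨hv0, ?_⟩
    by_contra hne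
    obtain ⟨n, hn⟩ := (hlim |α a - α b| (abs_pos.2 (sub_ne_zero.2 hne))).exists
    simp [hv0] at hn
  have hB : ∀ β ∈ B, 0 < β v := by
    intro β hβ
    have hpos : ∀ y ∈ g.1, 0 < β y := fun y hy => (hg ▸ hy : y ∈ {x | _}).2 β hβ
    by_contra! hle
    -- a vertex further out in the direction of the cone
    obtain ⟨t, ht⟩ := exists_nat_gt ((β a - β b + 1) / β g₀)
    rw [div_lt_iff₀ (hpos _ hg₀)] at ht
    have hc : Quot.mk (ConeRel F) (b + t • g₀, g) = Quot.mk (ConeRel F) (b, g) := by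
      refine hF.mk_eq_mk_iff.2 ⟨rfl, b + (t + 1) • g₀, ⟨g₀, hg₀, ?_⟩, ⟨(t + 1) • g₀, ?_, rfl⟩⟩
      · simp [add_smul, add_assoc]
      · rw [hg]
        have hg₀' := hg ▸ hg₀
        exact ⟨fun α hα => by rw [map_nsmul, hg₀'.1 α hα, smul_zero],
          fun γ hγ => by rw [map_nsmul]; exact nsmul_pos (hg₀'.2 γ hγ) (by omega)⟩
    obtain ⟨n, y, hy, hn⟩ := (hbound β _ hc 1 one_pos).exists
    have h1 := (abs_lt.1 hn).1
    have h2 := hpos y hy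
    have h3 : (n : ℝ) * β v ≤ 0 := mul_nonpos_of_nonneg_of_nonpos n.cast_nonneg hle
    simp only [map_add, map_nsmul, nsmul_eq_mul] at h1
    linarith
  have hvg : v ∈ g.1 := by
    rw [hg]
    exact ⟨fun α hα => (hA α hα).1, hB⟩
  obtain rfl : f = g := Subtype.ext (hF.eq_of_mem f.2 g.2 hv hvg)
  have hev' : ∀ᶠ n : ℕ in atTop, ∀ β ∈ B, β b - β a < n * β v :=
    B.eventually_all.2 fun β hβ =>
      (tendsto_natCast_atTop_atTop.atTop_mul_const (hB β hβ)).eventually_gt_atTop _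
  obtain ⟨n, hn, hn1⟩ := (hev'.and (eventually_ge_atTop 1)).exists
  refine hF.mk_eq_mk_iff.2 ⟨rfl, a + n • v, ⟨a - b + n • v, ?_, ?_⟩, ⟨n • v, ?_, rfl⟩⟩
  · rw [hg]
    refine ⟨fun α hα => ?_, fun β hβ => ?_⟩
    · simp [(hA α hα).1, (hA α hα).2]
    · have := hn β hβ
      simp only [map_add, map_sub, map_nsmul, nsmul_eq_mul]
      linarith
  · dsimp only
    abel
  · rw [hg]
    exact ⟨fun α hα => by rw [map_nsmul, (hA α hα).1, smul_zero],
      fun β hβ => by rw [map_nsmul]; exact nsmul_pos (hB β hβ) (by omega)⟩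

/-- The linear part of the inverse also permutes the finite family `F`. -/
lemma image_symm_mem (hF : IsAdmissibleConeDecomp V F) (e : V ≃ᵃ[ℝ] V)
    (he : ∀ f ∈ F, e.linear '' f ∈ F) : ∀ f ∈ F, e.symm.linear '' f ∈ F := by
  intro f hf
  have hsurj : SurjOn (fun s : Set V => e.linear '' s) F F :=
    ((hF.finite.injOn_iff_bijOn_of_mapsTo he).1 e.linear.injective.image_injective.injOn).surjOn
  obtain ⟨f', hf', rfl⟩ := hsurj hf
  simpa [image_image] using hf'

end IsAdmissibleConeDecomp

/-- The action on cones of an affine map whose linear part preserves the family `F`. -/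
def coneMap (e : V ≃ᵃ[ℝ] V) (he : ∀ f ∈ F, e.linear '' f ∈ F)
    (p : V × {f : Set V // f ∈ F}) : V × {f : Set V // f ∈ F} :=
  (e p.1, ⟨e.linear '' p.2.1, he _ p.2.2⟩)

lemma coneSet_coneMap (e : V ≃ᵃ[ℝ] V) (he : ∀ f ∈ F, e.linear '' f ∈ F)
    (p : V × {f : Set V // f ∈ F}) :
    coneSet (coneMap e he p).1 (coneMap e he p).2.1 = e '' coneSet p.1 p.2.1 := by
  simp only [coneSet, coneMap, image_image]
  refine image_congr fun x _ => ?_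
  have := e.map_vadd p.1 x
  simp only [vadd_eq_add] at this
  rw [add_comm p.1 x, this, add_comm]

lemma coneMap_symm_coneMap (e : V ≃ᵃ[ℝ] V) (he : ∀ f ∈ F, e.linear '' f ∈ F)
    (he' : ∀ f ∈ F, e.symm.linear '' f ∈ F) (p : V × {f : Set V // f ∈ F}) :
    coneMap e.symm he' (coneMap e he p) = p := by
  refine Prod.ext (e.symm_apply_apply _) (Subtype.ext ?_)
  simp [coneMap, image_image]

lemma coneMap_coneMap_symm (e : V ≃ᵃ[ℝ] V) (he : ∀ f ∈ F, e.linear '' f ∈ F)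
    (he' : ∀ f ∈ F, e.symm.linear '' f ∈ F) (p : V × {f : Set V // f ∈ F}) :
    coneMap e he (coneMap e.symm he' p) = p := by
  refine Prod.ext (e.apply_symm_apply _) (Subtype.ext ?_)
  simp [coneMap, image_image]

lemma ConeRel.coneMap {e : V ≃ᵃ[ℝ] V} (he : ∀ f ∈ F, e.linear '' f ∈ F)
    {p q : V × {f : Set V // f ∈ F}} (h : ConeRel F p q) :
    ConeRel F (coneMap e he p) (coneMap e he q) := by
  refine ⟨Subtype.ext (by simp [_root_.coneMap, h.1]), ?_⟩
  rw [coneSet_coneMap, coneSet_coneMap, ← image_inter e.injective]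
  exact h.2.image e

/-- The map `[g] ↦ [e(g)]` on the compactification. -/
def compactificationMap (e : V ≃ᵃ[ℝ] V) (he : ∀ f ∈ F, e.linear '' f ∈ F) :
    ConeCompactification F → ConeCompactification F :=
  Quot.map (coneMap e he) fun _ _ h => h.coneMap he

lemma continuous_compactificationMap [FiniteDimensional ℝ V]
    {T : TopologicalSpace (ConeCompactification F)} (hT : IsConeTopology F T)
    (e : V ≃ᵃ[ℝ] V) (he : ∀ f ∈ F, e.linear '' f ∈ F)
    (he' : ∀ f ∈ F, e.symm.linear '' f ∈ F) :
    Continuous (compactificationMap e he) := by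
  refine continuous_iff_continuousAt.2 fun x => ((hT _).tendsto_iff (hT _)).2 ?_
  rintro ⟨q, U⟩ ⟨hq, hU⟩
  dsimp only at hq hU
  have hL : Continuous e.linear := e.linear.toLinearMap.continuous_of_finiteDimensional
  refine ⟨(coneMap e.symm he' q, e.linear ⁻¹' U), ⟨?_, ?_⟩, ?_⟩
  · have := congrArg (compactificationMap e.symm he') hq
    obtain ⟨p, rfl⟩ := Quot.exists_rep x
    simpa [compactificationMap, Quot.map, coneMap_symm_coneMap] using this
  · exact hL.continuousAt.preimage_mem_nhds (by simpa using hU)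
  · rintro _ ⟨r, rfl, hr⟩
    refine ⟨coneMap e he r, rfl, ?_⟩
    rw [coneSet_coneMap]
    rintro _ ⟨z, hz, rfl⟩
    obtain ⟨y, hy, u, hu, rfl⟩ := hr hz
    rw [coneSet_coneMap] at hy
    obtain ⟨y, hy, rfl⟩ := hy
    refine ⟨y, hy, e.linear u, hu, ?_⟩
    have := e.map_vadd (e.symm y) u
    simp only [vadd_eq_add, e.apply_symm_apply] at this
    dsimp only
    rw [add_comm (e.symm y), this, add_comm]

end ConeCompactification

/-- **Proposition 3.3.1.** Let `w` be a bijective affine automorphism of `V` whose linear part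
maps every member of `F` onto a member of `F`.  Then `w̃ : [g] ↦ [w(g)]` is a well-defined
homeomorphism of `V̄`, and it is the unique continuous extension of `w` to `V̄` (i.e. the unique
continuous map satisfying `w̃ ∘ i = i ∘ w`, where `i` is the canonical injection). -/
theorem affine_map_extends_to_homeomorph
    {V : Type*} [NormedAddCommGroup V] [InnerProductSpace ℝ V] [FiniteDimensional ℝ V]
    {F : Set (Set V)} (hF : IsAdmissibleConeDecomp V F)
    (T : TopologicalSpace (ConeCompactification F)) (hT : IsConeTopology F T)
    (w : V →ᵃ[ℝ] V) (hw : Function.Bijective w)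
    (hmap : ∀ f ∈ F, w.linear '' f ∈ F) :
    ∃ h : @Homeomorph (ConeCompactification F) (ConeCompactification F) T T,
      (∀ (a : V) (f : Set V) (hf : f ∈ F),
          h (Quot.mk (ConeRel F) (a, ⟨f, hf⟩)) =
            Quot.mk (ConeRel F) (w a, ⟨w.linear '' f, hmap f hf⟩)) ∧
      ∀ u : ConeCompactification F → ConeCompactification F,
        @Continuous (ConeCompactification F) (ConeCompactification F) T T u →
        (∀ v : V, u (Quot.mk (ConeRel F) (v, ⟨({0} : Set V), hF.zero_mem⟩)) =
            Quot.mk (ConeRel F) (w v, ⟨({0} : Set V), hF.zero_mem⟩)) →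
        u = ⇑h := by
  let e : V ≃ᵃ[ℝ] V := AffineEquiv.ofBijective hw
  have he : ∀ f ∈ F, e.linear '' f ∈ F := hmap
  have he' := hF.image_symm_mem e he
  let h : @Homeomorph (ConeCompactification F) (ConeCompactification F) T T :=
    { toFun := compactificationMap e he
      invFun := compactificationMap e.symm he'
      left_inv := by
        rintro ⟨p⟩
        exact congrArg (Quot.mk _) (coneMap_symm_coneMap e he he' p)
      right_inv := by
        rintro ⟨p⟩
        exact congrArg (Quot.mk _) (coneMap_coneMap_symm e he he' p)
      continuous_toFun := continuous_compactificationMap hT e he he'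
      continuous_invFun := continuous_compactificationMap hT e.symm he' he }
  refine ⟨h, fun a f hf => rfl, fun u hu hext => ?_⟩
  ext x
  obtain ⟨⟨a, f⟩, rfl⟩ := Quot.exists_rep x
  obtain ⟨v, hv⟩ := hF.nonempty _ f.2
  refine hF.eq_of_tendsto_ray hT (w a) ⟨w.linear '' f.1, hmap _ f.2⟩
    (mem_image_of_mem w.linear hv) ?_
  refine (((hu.tendsto _).comp (hF.tendsto_ray hT a f hv))).congr fun n => ?_
  have hwn : w (a + n • v) = w a + n • w.linear v := by
    have := w.map_vadd a (n • v)
    simp only [vadd_eq_add, map_nsmul] at this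
    rw [add_comm a, this, add_comm]
  rw [Function.comp_apply, hext, hwn]
end

section
/- Let V be a finite-dimensional real vector space, G a finite group of linear automorphisms of V, and F a family of pairwise disjoint nonempty convex cones in V such that g·f ∈ F for every g ∈ G and f ∈ F. For f ∈ F let G_f = {g ∈ G : g(f) = f} and δ(f) = {x ∈ f : g(x) = x for all g ∈ G_f} (the core of f). Then: (1) δ(g·f) = g·δ(f) for all g ∈ G and f ∈ F; (2) δ(f) is a nonempty convex cone; (3) if f ≠ g in F then δ(f) ∩ δ(g) = ∅; (4) for every w ∈ G, w(f) = f if and only if w fixes δ(f) pointwise. (Proposition 3.3.3, points 1, 2, 3, 5) -/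
/-- A convex cone: a nonempty subset stable under addition and under multiplication by strictly
positive scalars. -/
def IsConvexCone {V : Type*} [AddCommGroup V] [Module ℝ V] (s : Set V) : Prop :=
  s.Nonempty ∧ (∀ x ∈ s, ∀ y ∈ s, x + y ∈ s) ∧ ∀ t : ℝ, 0 < t → ∀ x ∈ s, t • x ∈ s

/-- The core `δ(f)` of a cone `f` with respect to a group `G` of linear automorphisms:
the set of points of `f` fixed by every element of `G` stabilizing `f`. -/
def coneCore {V : Type*} [AddCommGroup V] [Module ℝ V]
    (G : Subgroup (V ≃ₗ[ℝ] V)) (f : Set V) : Set V :=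
  {x ∈ f | ∀ g : V ≃ₗ[ℝ] V, g ∈ G → g '' f = f → g x = x}

section Cone

variable {V : Type*} [AddCommGroup V] [Module ℝ V]

theorem image_mul_linearEquiv (g h : V ≃ₗ[ℝ] V) (f : Set V) :
    (g * h : V ≃ₗ[ℝ] V) '' f = g '' (h '' f) :=
  Set.image_comp g h f

theorem image_inv_linearEquiv_eq {g : V ≃ₗ[ℝ] V} {f f' : Set V} (h : g '' f = f') :
    (g⁻¹ : V ≃ₗ[ℝ] V) '' f' = f := by
  rw [← h, ← image_mul_linearEquiv, inv_mul_cancel]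
  exact Set.image_id f

theorem image_coneCore_subset {G : Subgroup (V ≃ₗ[ℝ] V)} {g : V ≃ₗ[ℝ] V} (hg : g ∈ G)
    (f : Set V) : g '' coneCore G f ⊆ coneCore G (g '' f) := by
  rintro _ ⟨x, ⟨hxf, hx⟩, rfl⟩
  refine ⟨⟨x, hxf, rfl⟩, fun h hh hfix => ?_⟩
  have key : (g⁻¹ * (h * g)) x = x := by
    refine hx _ (G.mul_mem (G.inv_mem hg) (G.mul_mem hh hg)) ?_
    rw [image_mul_linearEquiv, image_mul_linearEquiv, hfix]
    exact image_inv_linearEquiv_eq rfl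
  have key' : (g * (g⁻¹ * (h * g))) x = g x := congrArg g key
  rwa [mul_inv_cancel_left] at key'

theorem coneCore_image {G : Subgroup (V ≃ₗ[ℝ] V)} {g : V ≃ₗ[ℝ] V} (hg : g ∈ G) (f : Set V) :
    coneCore G (g '' f) = g '' coneCore G f := by
  refine Set.Subset.antisymm ?_ (image_coneCore_subset hg f)
  have h := Set.image_mono (f := g) (image_coneCore_subset (G.inv_mem hg) (g '' f))
  rw [image_inv_linearEquiv_eq rfl, ← image_mul_linearEquiv, mul_inv_cancel] at h
  exact (Set.image_id _).symm.subset.trans h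

theorem IsConvexCone.nonempty_coneCore {G : Subgroup (V ≃ₗ[ℝ] V)}
    (hG : (G : Set (V ≃ₗ[ℝ] V)).Finite) {f : Set V} (hf : IsConvexCone f) :
    (coneCore G f).Nonempty := by
  classical
  obtain ⟨⟨x, hx⟩, hadd, -⟩ := hf
  have hS : {g : V ≃ₗ[ℝ] V | g ∈ G ∧ g '' f = f}.Finite := hG.subset fun g hg => hg.1
  have hmem : ∀ g, g ∈ hS.toFinset ↔ g ∈ G ∧ g '' f = f := fun g => hS.mem_toFinset
  refine ⟨∑ g ∈ hS.toFinset, g x, ?_, fun h hh hfix => ?_⟩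
  · refine Finset.sum_induction_nonempty _ (· ∈ f) (fun a b ha hb => hadd a ha b hb) ?_ ?_
    · exact ⟨1, (hmem 1).2 ⟨G.one_mem, Set.image_id f⟩⟩
    · intro g hg
      exact ((hmem g).1 hg).2.subset ⟨x, hx, rfl⟩
  · rw [map_sum]
    refine Finset.sum_equiv (Equiv.mulLeft h) (fun g => ?_) fun g _ => rfl
    rw [hmem, hmem, Equiv.coe_mulLeft, G.mul_mem_cancel_left hh, image_mul_linearEquiv]
    refine and_congr_right fun _ => ⟨fun hg => by rw [hg, hfix], fun hg => ?_⟩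
    exact h.injective.image_injective (hg.trans hfix.symm)

theorem IsConvexCone.coneCore {G : Subgroup (V ≃ₗ[ℝ] V)}
    (hG : (G : Set (V ≃ₗ[ℝ] V)).Finite) {f : Set V} (hf : IsConvexCone f) :
    IsConvexCone (coneCore G f) := by
  refine ⟨hf.nonempty_coneCore hG, fun x hx y hy => ⟨hf.2.1 x hx.1 y hy.1, fun g hg hfix => ?_⟩,
    fun t ht x hx => ⟨hf.2.2 t ht x hx.1, fun g hg hfix => ?_⟩⟩
  · rw [map_add, hx.2 g hg hfix, hy.2 g hg hfix]
  · rw [map_smul, hx.2 g hg hfix]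

end Cone

/-- **Proposition 3.3.3 (points 1, 2, 3, 5).** Let `G` be a finite group of linear automorphisms
of a finite-dimensional real vector space `V` and `F` a `G`-stable family of pairwise disjoint
nonempty convex cones.  Then (1) `δ(g • f) = g • δ(f)`; (2) each core `δ(f)` is a nonempty convex
cone; (3) cores of distinct members of `F` are disjoint; (4) `w ∈ G` stabilizes `f` iff it fixes
`δ(f)` pointwise. -/
theorem coneCore_properties
    {V : Type*} [AddCommGroup V] [Module ℝ V] [FiniteDimensional ℝ V]
    (G : Subgroup (V ≃ₗ[ℝ] V)) (hGfin : (G : Set (V ≃ₗ[ℝ] V)).Finite)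
    (F : Set (Set V))
    (hcone : ∀ f ∈ F, IsConvexCone f)
    (hdisj : ∀ f ∈ F, ∀ g ∈ F, f ≠ g → f ∩ g = ∅)
    (hstab : ∀ g : V ≃ₗ[ℝ] V, g ∈ G → ∀ f ∈ F, g '' f ∈ F) :
    (∀ g : V ≃ₗ[ℝ] V, g ∈ G → ∀ f ∈ F, coneCore G (g '' f) = g '' coneCore G f) ∧
    (∀ f ∈ F, IsConvexCone (coneCore G f)) ∧
    (∀ f ∈ F, ∀ g ∈ F, f ≠ g → coneCore G f ∩ coneCore G g = ∅) ∧
    (∀ w : V ≃ₗ[ℝ] V, w ∈ G → ∀ f ∈ F, (w '' f = f ↔ ∀ x ∈ coneCore G f, w x = x)) := by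
  refine ⟨fun g hg f _ => coneCore_image hg f, fun f hf => (hcone f hf).coneCore hGfin,
    fun f hf g hg hne => ?_, fun w hw f hf => ⟨fun hfix x hx => hx.2 w hw hfix, fun hfix => ?_⟩⟩
  · exact Set.subset_empty_iff.1 fun x hx => (hdisj f hf g hg hne).subset ⟨hx.1.1, hx.2.1⟩
  · by_contra hne
    obtain ⟨x, hx⟩ := (hcone f hf).nonempty_coneCore hGfin
    exact (hdisj _ (hstab w hw f hf) f hf hne).subset ⟨⟨x, hx.1, hfix x hx⟩, hx.1⟩
end

section
/- Let V be a finite-dimensional real vector space, G a finite group of linear automorphisms of V, and F a family of pairwise disjoint nonempty convex cones in V, none of which contains an affine line, such that g·f ∈ F for every g ∈ G and f ∈ F. For f ∈ F let G_f = {g ∈ G : g(f) = f} and δ(f) = {x ∈ f : g(x) = x for all g ∈ G_f}; for x ∈ V the core of the affine cone x + f is δ(x + f) := x + δ(f). Then every core is the core of exactly one affine cone: if x, y ∈ V and f, g ∈ F satisfy x + δ(f) = y + δ(g), then x = y and f = g, hence x + f = y + g. (Proposition 3.3.5) -/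
/-- If a finite group acts linearly, the sum over the stabilizer of a cone of the images of one of
its points lies in the core, so the core is nonempty. -/
theorem coneCore_nonempty {V : Type*} [AddCommGroup V] [Module ℝ V]
    (G : Subgroup (V ≃ₗ[ℝ] V)) (hG : (G : Set (V ≃ₗ[ℝ] V)).Finite)
    {f : Set V} (hf : IsConvexCone f) : (coneCore G f).Nonempty := by
  classical
  obtain ⟨⟨v, hv⟩, hadd, -⟩ := hf
  have hfin : {σ : V ≃ₗ[ℝ] V | σ ∈ G ∧ σ '' f = f}.Finite := hG.subset fun _ hσ => hσ.1
  have hmul : ∀ σ τ : V ≃ₗ[ℝ] V, σ '' f = f → τ '' f = f → (σ * τ) '' f = f := by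
    intro σ τ hσ hτ
    conv_rhs => rw [← hσ, ← hτ, ← Set.image_comp]
    rfl
  have hinv : ∀ σ : V ≃ₗ[ℝ] V, σ '' f = f → (σ⁻¹ : V ≃ₗ[ℝ] V) '' f = f := by
    intro σ hσ
    conv_lhs => rw [← hσ]
    exact Function.LeftInverse.image_image σ.symm_apply_apply f
  refine ⟨∑ σ ∈ hfin.toFinset, σ v, ?_, ?_⟩
  · refine Finset.sum_induction_nonempty _ (· ∈ f) (fun a b ha hb => hadd a ha b hb) ⟨1, ?_⟩ ?_
    · rw [Set.Finite.mem_toFinset]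
      exact ⟨G.one_mem, Set.image_id f⟩
    · intro σ hσ
      rw [Set.Finite.mem_toFinset] at hσ
      exact hσ.2 ▸ Set.mem_image_of_mem σ hv
  · intro τ hτ hτf
    rw [map_sum]
    refine Finset.sum_equiv (Equiv.mulLeft τ) (fun σ => ?_) (fun σ _ => rfl)
    simp only [Set.Finite.mem_toFinset, Set.mem_ofPred_eq, Equiv.coe_mulLeft]
    refine ⟨fun hσ => ⟨G.mul_mem hτ hσ.1, hmul τ σ hτf hσ.2⟩, fun hσ => ?_⟩
    have key := hmul τ⁻¹ (τ * σ) (hinv τ hτf) hσ.2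
    rw [inv_mul_cancel_left] at key
    exact ⟨(G.mul_mem_cancel_left hτ).1 hσ.1, key⟩

theorem smul_mem_coneCore {V : Type*} [AddCommGroup V] [Module ℝ V]
    (G : Subgroup (V ≃ₗ[ℝ] V)) {f : Set V} (hf : IsConvexCone f) {t : ℝ} (ht : 0 < t) {a : V}
    (ha : a ∈ coneCore G f) : t • a ∈ coneCore G f :=
  ⟨hf.2.2 t ht a ha.1, fun σ hσ hσf => by rw [map_smul, ha.2 σ hσ hσf]⟩

/-- If a translate by `d` maps a set stable under positive scalings into another such set, so do
all translates by positive multiples of `d`. -/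
theorem add_smul_mem_of_forall_add_mem {V : Type*} [AddCommGroup V] [Module ℝ V] {A B : Set V}
    (hA : ∀ t : ℝ, 0 < t → ∀ a ∈ A, t • a ∈ A) (hB : ∀ t : ℝ, 0 < t → ∀ b ∈ B, t • b ∈ B)
    {d : V} (h : ∀ b ∈ B, b + d ∈ A) {b : V} (hb : b ∈ B) {t : ℝ} (ht : 0 < t) :
    b + t • d ∈ A := by
  have key := hA t ht _ (h _ (hB t⁻¹ (inv_pos.2 ht) b hb))
  rwa [smul_add, smul_inv_smul₀ ht.ne'] at key

/-- **Proposition 3.3.5.** Let `G` be a finite group of linear automorphisms of a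
finite-dimensional real vector space `V` and `F` a `G`-stable family of pairwise disjoint
nonempty convex cones, none of which contains an affine line.  The core `x + δ(f)` of the affine
cone `x + f` determines it: if `x + δ(f) = y + δ(g)` (with `f, g ∈ F`), then `x = y` and
`f = g`, hence `x + f = y + g`. -/
theorem coneCore_affine_unique
    {V : Type*} [AddCommGroup V] [Module ℝ V] [FiniteDimensional ℝ V]
    (G : Subgroup (V ≃ₗ[ℝ] V)) (hGfin : (G : Set (V ≃ₗ[ℝ] V)).Finite)
    (F : Set (Set V))
    (hcone : ∀ f ∈ F, IsConvexCone f)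
    (hline : ∀ f ∈ F, ∀ c d : V, d ≠ 0 → ¬ (∀ t : ℝ, c + t • d ∈ f))
    (hdisj : ∀ f ∈ F, ∀ g ∈ F, f ≠ g → f ∩ g = ∅)
    (hstab : ∀ g : V ≃ₗ[ℝ] V, g ∈ G → ∀ f ∈ F, g '' f ∈ F)
    (f : Set V) (hf : f ∈ F) (g : Set V) (hg : g ∈ F) (x y : V)
    (h : (x + ·) '' coneCore G f = (y + ·) '' coneCore G g) :
    x = y ∧ f = g := by
  have hA : ∀ t : ℝ, 0 < t → ∀ a ∈ coneCore G f, t • a ∈ coneCore G f :=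
    fun t ht a ha => smul_mem_coneCore G (hcone f hf) ht ha
  have hB : ∀ t : ℝ, 0 < t → ∀ b ∈ coneCore G g, t • b ∈ coneCore G g :=
    fun t ht b hb => smul_mem_coneCore G (hcone g hg) ht hb
  have hBA : ∀ b ∈ coneCore G g, b + (y - x) ∈ coneCore G f := by
    intro b hb
    obtain ⟨a, ha, hab⟩ : y + b ∈ (x + ·) '' coneCore G f := h ▸ ⟨b, hb, rfl⟩
    have hab : x + a = y + b := hab
    have : b + (y - x) = a := by rw [eq_sub_of_add_eq' hab]; abel
    rwa [this]
  have hAB : ∀ a ∈ coneCore G f, a + (x - y) ∈ coneCore G g := by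
    intro a ha
    obtain ⟨b, hb, hab⟩ : x + a ∈ (y + ·) '' coneCore G g := h ▸ ⟨a, ha, rfl⟩
    have hab : y + b = x + a := hab
    have : a + (x - y) = b := by rw [eq_sub_of_add_eq' hab]; abel
    rwa [this]
  obtain ⟨b, hb⟩ := coneCore_nonempty G hGfin (hcone g hg)
  have hxy : x = y := by
    by_contra hne
    refine hline g hg b (y - x) (sub_ne_zero.2 (Ne.symm hne)) fun t => ?_
    have h₁ := add_smul_mem_of_forall_add_mem hA hB hBA hb (t := |t| + t + 1)
      (by linarith [neg_abs_le t])
    have h₂ := add_smul_mem_of_forall_add_mem hB hA hAB h₁ (t := |t| + 1) (by positivity)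
    convert h₂.1 using 1
    module
  refine ⟨hxy, ?_⟩
  by_contra hne
  have hbf : b ∈ f := by simpa [hxy] using (hBA b hb).1
  exact (hdisj f hf g hg hne).subset ⟨hbf, hb.1⟩
end

section
/- Let V be a finite-dimensional real vector space and let f, g, h be nonempty convex cones in V such that g and h are open in their respective linear spans and f ⊆ closure(g) ∩ closure(h). Let y, z ∈ V. If (y + g + span(f)) ∩ (z + h + span(f)) ≠ ∅ (equivalently, the images of y + g and z + h under the quotient map V → V/span(f) intersect), then (y + g) ∩ (z + h) ≠ ∅. (Lemme 8.2.3) -/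
open Pointwise

/-- A convex cone that is open in its linear span absorbs its closure. -/
theorem IsConvexCone.add_mem_of_mem_closure
    {V : Type*} [NormedAddCommGroup V] [NormedSpace ℝ V] [FiniteDimensional ℝ V]
    {g : Set V} (hg : IsConvexCone g)
    (hgopen : ∃ O : Set V, IsOpen O ∧ g = O ∩ (Submodule.span ℝ g : Set V))
    {a p : V} (ha : a ∈ g) (hp : p ∈ closure g) : a + p ∈ g := by
  obtain ⟨O, hO, hgO⟩ := hgopen
  have hsub : closure g ⊆ (Submodule.span ℝ g : Set V) :=
    closure_minimal Submodule.subset_span (Submodule.closed_of_finiteDimensional _)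
  have haO : a ∈ O := by
    rw [hgO] at ha
    exact ha.1
  have hU : IsOpen ((fun x : V => a + p - x) ⁻¹' O) := hO.preimage (by fun_prop)
  obtain ⟨x, hxO, hxg⟩ := mem_closure_iff.mp hp _ hU (by simpa using haO)
  have hmem : a + p - x ∈ g := by
    rw [hgO]
    exact ⟨hxO, sub_mem (add_mem (Submodule.subset_span ha) (hsub hp))
      (Submodule.subset_span hxg)⟩
  simpa using hg.2.1 _ hmem _ hxg

/-- Every element of the span of a convex cone is a difference of two elements of the cone. -/
theorem IsConvexCone.exists_sub_of_mem_span {V : Type*} [AddCommGroup V] [Module ℝ V]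
    {f : Set V} (hf : IsConvexCone f) {s : V} (hs : s ∈ Submodule.span ℝ f) :
    ∃ p ∈ f, ∃ q ∈ f, s = p - q := by
  obtain ⟨⟨c, hc⟩, hadd, hsmul⟩ := hf
  induction hs using Submodule.span_induction with
  | mem x hx => exact ⟨x + x, hadd _ hx _ hx, x, hx, by abel⟩
  | zero => exact ⟨c, hc, c, hc, by simp⟩
  | add x y _ _ hx hy =>
    obtain ⟨p, hp, q, hq, rfl⟩ := hx
    obtain ⟨p', hp', q', hq', rfl⟩ := hy
    exact ⟨p + p', hadd _ hp _ hp', q + q', hadd _ hq _ hq', by abel⟩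
  | smul t x _ hx =>
    obtain ⟨p, hp, q, hq, rfl⟩ := hx
    rcases lt_trichotomy t 0 with ht | rfl | ht
    · exact ⟨(-t) • q, hsmul _ (by linarith) _ hq, (-t) • p, hsmul _ (by linarith) _ hp, by module⟩
    · exact ⟨c, hc, c, hc, by simp⟩
    · exact ⟨t • p, hsmul _ ht _ hp, t • q, hsmul _ ht _ hq, by module⟩

/-- **Lemme 8.2.3.** Let `f, g, h` be nonempty convex cones with `g` and `h` open in their linear
spans and `f ⊆ closure g ∩ closure h`.  If the images of `y + g` and `z + h` modulo `span f`
intersect, then `(y + g) ∩ (z + h) ≠ ∅`. -/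
theorem cones_intersect_of_proj_intersect
    {V : Type*} [NormedAddCommGroup V] [NormedSpace ℝ V] [FiniteDimensional ℝ V]
    (f g h : Set V) (hf : IsConvexCone f) (hg : IsConvexCone g) (hh : IsConvexCone h)
    (hgopen : ∃ O : Set V, IsOpen O ∧ g = O ∩ (Submodule.span ℝ g : Set V))
    (hhopen : ∃ O : Set V, IsOpen O ∧ h = O ∩ (Submodule.span ℝ h : Set V))
    (hfsub : f ⊆ closure g ∩ closure h)
    (y z : V)
    (hne : ((((y + ·) '' g) + (Submodule.span ℝ f : Set V)) ∩
        (((z + ·) '' h) + (Submodule.span ℝ f : Set V))).Nonempty) :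
    (((y + ·) '' g) ∩ ((z + ·) '' h)).Nonempty := by
  obtain ⟨_, ⟨_, ⟨a, ha, rfl⟩, s, hs, rfl⟩, _, ⟨b, hb, rfl⟩, t, ht, heq⟩ := hne
  obtain ⟨p, hp, q, hq, hpq⟩ := hf.exists_sub_of_mem_span (sub_mem hs ht)
  refine ⟨y + (a + p), ⟨_, hg.add_mem_of_mem_closure hgopen ha (hfsub hp).1, rfl⟩,
    b + q, hh.add_mem_of_mem_closure hhopen hb (hfsub hq).2, ?_⟩
  have hp' : p = s - t + q := by rw [hpq]; abel
  have hb' : z + b = y + a + s - t := eq_sub_of_add_eq heq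
  calc z + (b + q) = z + b + q := by abel
    _ = y + (a + p) := by rw [hb', hp']; abel
end

section
/- Let V be a finite-dimensional real vector space and let F be a finite partition of V into nonempty sets such that the closure of every member of F is a union of members of F. Then for every f ∈ F and every x ∈ f, the union ⋃{g ∈ F : f ⊆ closure(g)} is a neighborhood of x in V. (covering part of Proposition 8.2.2) -/
/-- **Proposition 8.2.2 (covering part).** Let `F` be a finite partition of a finite-dimensional
real normed space `V` into nonempty sets such that the closure of every member of `F` is a union
of members of `F`.  Then, for every `f ∈ F` and every `x ∈ f`, the union of the members of `F`
containing `f` in their closure is a neighbourhood of `x`. -/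
theorem union_of_cofaces_mem_nhds
    {V : Type*} [NormedAddCommGroup V] [NormedSpace ℝ V] [FiniteDimensional ℝ V]
    (F : Set (Set V)) (hfin : F.Finite)
    (hne : ∀ f ∈ F, f.Nonempty)
    (hdisj : ∀ f ∈ F, ∀ g ∈ F, f ≠ g → f ∩ g = ∅)
    (hcover : ⋃₀ F = Set.univ)
    (hclosure : ∀ f ∈ F, ∃ G ⊆ F, closure f = ⋃₀ G)
    (f : Set V) (hf : f ∈ F) (x : V) (hx : x ∈ f) :
    ⋃₀ {g | g ∈ F ∧ f ⊆ closure g} ∈ nhds x := by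
  have hU : (⋃₀ {g | g ∈ F ∧ ¬ f ⊆ closure g})ᶜ ∈ nhds x := by
    have hclosed : IsClosed (⋃ g ∈ {g | g ∈ F ∧ ¬ f ⊆ closure g}, closure g) :=
      (hfin.subset fun _ hg => hg.1).isClosed_biUnion fun _ _ => isClosed_closure
    have hxn : x ∉ ⋃ g ∈ {g | g ∈ F ∧ ¬ f ⊆ closure g}, closure g := by
      simp only [Set.mem_iUnion, not_exists]
      rintro g ⟨hg, hfg⟩ hxg
      obtain ⟨G, hGF, hG⟩ := hclosure g hg
      rw [hG] at hxg hfg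
      obtain ⟨k, hk, hxk⟩ := hxg
      have hfk : f = k := by
        by_contra hfk
        exact (hdisj f hf k (hGF hk) hfk).subset ⟨hx, hxk⟩
      exact hfg (Set.subset_sUnion_of_mem (hfk ▸ hk))
    refine Filter.mem_of_superset (hclosed.isOpen_compl.mem_nhds hxn)
      (Set.compl_subset_compl.2 ?_)
    rintro y ⟨g, hg, hyg⟩
    exact Set.mem_biUnion hg (subset_closure hyg)
  refine Filter.mem_of_superset hU fun y hy => ?_
  obtain ⟨g, hg, hyg⟩ := hcover.superset (Set.mem_univ y)
  by_contra hyn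
  exact hy ⟨g, ⟨hg, fun hfg => hyn ⟨g, ⟨hg, hfg⟩, hyg⟩⟩, hyg⟩
end

section
/- Let V be a real vector space and let (α_i)_{i∈I}, (β_j)_{j∈J}, (γ_k)_{k∈K} be finite families of linear forms on V. Set g = {x ∈ V : α_i(x) > 0 ∀ i ∈ I, β_j(x) > 0 ∀ j ∈ J, γ_k(x) = 0 ∀ k ∈ K} and f = {x ∈ V : α_i(x) > 0 ∀ i ∈ I, β_j(x) = 0 ∀ j ∈ J, γ_k(x) = 0 ∀ k ∈ K}, and assume f ≠ ∅. Then g + span(f) = {x ∈ V : β_j(x) > 0 for all j ∈ J and γ_k(x) = 0 for all k ∈ K}; equivalently, the image of g under the quotient map V → V/span(f) is the set defined there by the induced forms β_j > 0 (j ∈ J) and γ_k = 0 (k ∈ K). (description of the projected cones in Proposition 8.2.2) -/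
open Pointwise

/-- If finitely many linear forms are positive at `y`, then they are all positive at `x + t • y`
for some scalar `t`. -/
theorem exists_forall_pos_add_smul {V : Type*} [AddCommGroup V] [Module ℝ V]
    (A : Finset (V →ₗ[ℝ] ℝ)) (x : V) {y : V} (hy : ∀ α ∈ A, 0 < α y) :
    ∃ t : ℝ, ∀ α ∈ A, 0 < α (x + t • y) := by
  have h : ∀ᶠ t : ℝ in Filter.atTop, ∀ α ∈ A, 0 < α (x + t • y) := by
    rw [Filter.eventually_all_finset]
    intro α hα
    filter_upwards [Filter.eventually_gt_atTop (-α x / α y)] with t ht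
    rw [div_lt_iff₀ (hy α hα)] at ht
    simp only [map_add, map_smul, smul_eq_mul]
    linarith
  exact h.exists

/-- **Proposition 8.2.2 (description of the projected cones).** Let `(α)_{A}`, `(β)_{B}`,
`(γ)_{C}` be finite families of linear forms on a real vector space `V`.  Set
`g = {x | α x > 0 on A, β x > 0 on B, γ x = 0 on C}` and
`f = {x | α x > 0 on A, β x = 0 on B, γ x = 0 on C}`, and assume `f ≠ ∅`.  Then
`g + span f = {x | β x > 0 on B and γ x = 0 on C}`. -/
theorem cone_add_span_face
    {V : Type*} [AddCommGroup V] [Module ℝ V]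
    (A B C : Finset (V →ₗ[ℝ] ℝ))
    (g f : Set V)
    (hg : g = {x : V | (∀ α ∈ A, 0 < α x) ∧ (∀ β ∈ B, 0 < β x) ∧ ∀ γ ∈ C, γ x = 0})
    (hf : f = {x : V | (∀ α ∈ A, 0 < α x) ∧ (∀ β ∈ B, β x = 0) ∧ ∀ γ ∈ C, γ x = 0})
    (hfne : f.Nonempty) :
    g + (Submodule.span ℝ f : Set V) =
      {x : V | (∀ β ∈ B, 0 < β x) ∧ ∀ γ ∈ C, γ x = 0} := by
  obtain ⟨y, hy⟩ := hfne
  have hspan : ∀ δ : V →ₗ[ℝ] ℝ, (∀ z ∈ f, δ z = 0) → ∀ s ∈ Submodule.span ℝ f, δ s = 0 :=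
    fun δ hδ s hs => (Submodule.span_le (p := LinearMap.ker δ)).2 hδ hs
  ext x
  constructor
  · rintro ⟨u, hu, s, hs, rfl⟩
    subst hg hf
    refine ⟨fun β hβ => ?_, fun γ hγ => ?_⟩
    · simpa [hspan β (fun z hz => hz.2.1 β hβ) s hs] using hu.2.1 β hβ
    · simpa [hspan γ (fun z hz => hz.2.2 γ hγ) s hs] using hu.2.2 γ hγ
  · rintro ⟨hβ, hγ⟩
    have hys : y ∈ Submodule.span ℝ f := Submodule.subset_span hy
    rw [hf] at hy
    obtain ⟨hyA, hyB, hyC⟩ := hy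
    obtain ⟨t, ht⟩ := exists_forall_pos_add_smul A x hyA
    refine ⟨x + t • y, ?_, -(t • y), neg_mem (Submodule.smul_mem _ t hys), by simp⟩
    rw [hg]
    refine ⟨ht, fun β hb => ?_, fun γ hc => ?_⟩
    · simpa [hyB β hb] using hβ β hb
    · simp [hyC γ hc, hγ γ hc]
end

section
/- Let V be a real normed vector space and let F, G ⊆ V be cones, i.e. tF ⊆ F and tG ⊆ G for every real t > 0, with F nonempty. Let x ∈ V and R ≥ 0. If every point of x + G is at distance at most R from F, then G ⊆ closure(F). (second part of Lemme 4.2.1: if the enclosure of one chimney is contained in that of another, the direction of the first is contained in the closed direction of the second) -/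
/-- **Lemme 4.2.1 (second part).** Let `F` and `G` be cones in a real normed space, with `F`
nonempty.  If every point of `x + G` is at distance at most `R` from `F`, then
`G ⊆ closure F`. -/
theorem cone_subset_closure_of_bounded_distance
    {V : Type*} [NormedAddCommGroup V] [NormedSpace ℝ V]
    (F G : Set V)
    (hF : ∀ t : ℝ, 0 < t → ∀ v ∈ F, t • v ∈ F)
    (hG : ∀ t : ℝ, 0 < t → ∀ v ∈ G, t • v ∈ G)
    (hFne : F.Nonempty)
    (x : V) (R : ℝ) (hR : 0 ≤ R)
    (h : ∀ v ∈ G, Metric.infDist (x + v) F ≤ R) :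
    G ⊆ closure F := by
  intro g hg
  rw [Metric.mem_closure_iff]
  intro ε hε
  obtain ⟨s, hs, hsε⟩ : ∃ s : ℝ, 0 < s ∧ s * ε = ‖x‖ + R + 1 :=
    ⟨(‖x‖ + R + 1) / ε, by positivity, div_mul_cancel₀ _ hε.ne'⟩
  obtain ⟨f, hf, hdist⟩ := (Metric.infDist_lt_iff hFne).1
    ((h (s • g) (hG s hs g hg)).trans_lt (lt_add_one R))
  refine ⟨s⁻¹ • f, hF _ (inv_pos.2 hs) f hf, ?_⟩
  have hclose : dist (s • g) f < s * ε := by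
    have htri := dist_triangle (s • g) (x + s • g) f
    rw [add_comm x, dist_self_add_right, add_comm _ x] at htri
    linarith
  have hscale : dist (s • g) f = s * dist g (s⁻¹ • f) := by
    conv_lhs => rw [← smul_inv_smul₀ hs.ne' f]
    rw [dist_smul₀, Real.norm_of_nonneg hs.le]
  rw [hscale] at hclose
  exact lt_of_mul_lt_mul_left hclose hs.le
end
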